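/- Let k ≥ 2 be an integer, α ∈ ℝ, 0 < β < 1 and x > 0. Then 𝓕_k(x; α, β) + 𝓕_k(x; α, −β) = (1/x)·Li_k(e^{2πiα}) + i·∫₀^∞ (1/(iu + x) + 1/(iu − x)) · [A(iu, 2−k, β, α) + A(iu, 2−k, −β, α)] du, where the integral converges absolutely. -/

import Mathlib

open Complex MeasureTheory Filter Topology Set Asymptotics

noncomputable section

/-- `e2pi θ = e^{2πiθ}`. -/
def e2pi (θ : ℝ) : ℂ := Complex.exp (2 * Real.pi * Complex.I * θ)

/-- Polylogarithm of integer order: `Li 0 z = z/(1-z)`, `Li 1 z = -Log(1-z)`,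
`Li m z = ∑_{n≥1} z^n/n^m` for `m ≥ 2`. -/
def Li : ℕ → ℂ → ℂ
  | 0, z => z / (1 - z)
  | 1, z => -Complex.log (1 - z)
  | (m+2), z => ∑' n : ℕ, z ^ (n+1) / ((n+1 : ℕ) : ℂ) ^ (m+2)

/-- The higher Herglotz–Zagier–Novikov function
`𝓕_k(x; α, β) = ∫₀^∞ Li_{k-1}(e^{-xt} e^{2πiα}) / (1 - e^{-t} e^{2πiβ}) dt`. -/
def HHZN (k : ℕ) (x : ℂ) (α β : ℝ) : ℂ :=
  ∫ t in Set.Ioi (0:ℝ),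
    Li (k-1) (Complex.exp (-x * t) * e2pi α) / (1 - Complex.exp (-(t:ℂ)) * e2pi β)

/-- Berndt's generalized Dedekind eta-function
`A(τ, s, β, α) = ∑_{m ∈ ℤ, m > -β} ∑_{n ≥ 1} n^{s-1} e^{2πin(α+βτ)} e^{2πimnτ}`. -/
def dedekindA (τ s : ℂ) (β α : ℝ) : ℂ :=
  ∑' m : {m : ℤ // -β < (m : ℝ)}, ∑' n : ℕ,
    ((n + 1 : ℕ) : ℂ) ^ (s - 1) *
      Complex.exp (2 * Real.pi * Complex.I * (n + 1) * ((α : ℂ) + (β : ℂ) * τ)) *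
      Complex.exp (2 * Real.pi * Complex.I * ((m : ℤ) : ℂ) * (n + 1) * τ)

/-- Poisson-type kernel -/
def pk (β : ℝ) (m : ℤ) (t : ℝ) : ℝ := 2 * t / (t ^ 2 + (2 * Real.pi * |m + β|) ^ 2)

lemma pk_nonneg (β : ℝ) (m : ℤ) {t : ℝ} (ht : 0 < t) : 0 ≤ pk β m t := by
  unfold pk; positivity

lemma pk_eq_im (β : ℝ) (m : ℤ) {t : ℝ} (ht : 0 < t) :
    pk β m t = -(1 / Real.pi) * (1 / (((β : ℂ) + (t / (2 * Real.pi) : ℝ) * I) + m)).im := by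
  have hpi := Real.pi_pos
  rw [one_div (_ + _), Complex.inv_im]
  simp only [Complex.normSq_apply, Complex.add_im, Complex.add_re, Complex.mul_im, Complex.mul_re,
    Complex.ofReal_re, Complex.ofReal_im, Complex.I_re, Complex.I_im, Complex.intCast_re,
    Complex.intCast_im]
  unfold pk
  rw [mul_pow, sq_abs]
  have h1 : t ^ 2 + (2 * Real.pi) ^ 2 * (m + β) ^ 2 ≠ 0 := by positivity
  have h2 : (β + (t / (2 * Real.pi) * 0 - 0 * 1) + m) * (β + (t / (2 * Real.pi) * 0 - 0 * 1) + m)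
    + (0 + (t / (2 * Real.pi) * 1 + 0 * 0) + 0) * (0 + (t / (2 * Real.pi) * 1 + 0 * 0) + 0)
      = (t ^ 2 + (2 * Real.pi) ^ 2 * (m + β) ^ 2) / (2 * Real.pi) ^ 2 := by
    field_simp
    ring
  rw [h2]
  field_simp
  ring

lemma pk_hasSum (β : ℝ) {t : ℝ} (ht : 0 < t) :
    HasSum (fun m : ℤ => pk β m t)
      (2 * (1 / (1 - Complex.exp (-(t:ℂ)) * e2pi β)).re - 1) := by
  have hpi := Real.pi_pos
  set z : ℂ := (β : ℂ) + (t / (2 * Real.pi) : ℝ) * I with hz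
  have hzim : z.im = t / (2 * Real.pi) := by
    rw [hz]; simp only [Complex.add_im, Complex.mul_im, Complex.ofReal_re, Complex.ofReal_im,
      Complex.I_re, Complex.I_im]; ring
  have hzC : z ∈ Complex.integerComplement := by
    rintro ⟨n, hn⟩
    have : z.im = 0 := by rw [← hn]; simp
    rw [hzim] at this
    have : 0 < t / (2 * Real.pi) := by positivity
    linarith
  have hs := (summable_cotTerm hzC).hasSum
  rw [← cot_series_rep' hzC] at hs
  have hs2 := (Complex.hasSum_im hs).mul_left (-(1 / Real.pi))
  have hterm : (fun n : ℕ => -(1 / Real.pi) * (cotTerm z n).im)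
      = fun n : ℕ => pk β ((n : ℤ) + 1) t + pk β (-((n : ℤ) + 1)) t := by
    funext n
    rw [pk_eq_im β _ ht, pk_eq_im β _ ht]
    simp only [cotTerm, Complex.add_im]
    rw [← hz, sub_eq_add_neg]
    push_cast
    ring
  rw [hterm] at hs2
  have s1 : Summable (fun n : ℕ => pk β ((n : ℤ) + 1) t) :=
    Summable.of_nonneg_of_le (fun n => pk_nonneg _ _ ht)
      (fun n => le_add_of_nonneg_right (pk_nonneg _ _ ht)) hs2.summable
  have s2 : Summable (fun n : ℕ => pk β (-((n : ℤ) + 1)) t) :=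
    Summable.of_nonneg_of_le (fun n => pk_nonneg _ _ ht)
      (fun n => le_add_of_nonneg_left (pk_nonneg _ _ ht)) hs2.summable
  have h3 := HasSum.of_add_one_of_neg_add_one (f := fun m : ℤ => pk β m t) s1.hasSum s2.hasSum
  have h4 := (s1.hasSum.add s2.hasSum).unique hs2
  convert h3 using 1
  have h0 : pk β 0 t = -(1 / Real.pi) * (1 / z).im := by
    rw [pk_eq_im β 0 ht]; simp [hz]
  rw [add_right_comm, h4, h0, Complex.sub_im, cot_pi_eq_exp_ratio]
  have hw : Complex.exp (2 * Real.pi * I * z) = Complex.exp (-(t:ℂ)) * e2pi β := by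
    rw [e2pi, ← Complex.exp_add]
    congr 1
    rw [hz]
    push_cast
    have : (Real.pi : ℂ) ≠ 0 := by exact_mod_cast hpi.ne'
    field_simp
    ring_nf
    simp
    ring
  rw [hw]
  set w := Complex.exp (-(t:ℂ)) * e2pi β
  have hw1 : 1 - w ≠ 0 := by
    intro h
    have : ‖w‖ = 1 := by rw [← sub_eq_zero.mp h]; simp
    have h2 : ‖w‖ = Real.exp (-t) := by
      simp only [w, e2pi, norm_mul, Complex.norm_exp]
      simp
    rw [h2] at this
    have := Real.exp_lt_one_iff.mpr (show -t < 0 by linarith)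
    linarith
  have : (Real.pi : ℂ) * ((w + 1) / (I * (1 - w))) = (Real.pi : ℂ) * (I * (1 - 2 * (1 / (1 - w)))) := by
    congr 1
    field_simp
    simp
    ring
  rw [this, Complex.im_ofReal_mul, Complex.I_mul_im]
  have h5 : (1 - 2 * (1 / (1 - w))).re = 1 - 2 * (1 / (1 - w)).re := by
    simp
  rw [h5]
  field_simp
  ring

lemma norm_exp_e2pi (β t : ℝ) : ‖Complex.exp (-(t:ℂ)) * e2pi β‖ = Real.exp (-t) := by
  simp only [e2pi, norm_mul, Complex.norm_exp]
  simp

lemma e2pi_ne_one {β : ℝ} (hβ0 : 0 < β) (hβ1 : β < 1) : e2pi β ≠ 1 := by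
  intro h
  rw [e2pi, Complex.exp_eq_one_iff] at h
  obtain ⟨n, hn⟩ := h
  have hpi : (2 * Real.pi * I : ℂ) ≠ 0 := by simp [Real.pi_ne_zero]
  rw [mul_comm (n : ℂ)] at hn
  have := mul_left_cancel₀ hpi hn
  have h2 : β = n := by exact_mod_cast this
  rw [h2] at hβ0 hβ1
  have : 0 < n := by exact_mod_cast hβ0
  have : n < 1 := by exact_mod_cast hβ1
  omega

lemma e2pi_neg (β : ℝ) : e2pi (-β) = (starRingEnd ℂ) (e2pi β) := by
  rw [e2pi, e2pi, ← Complex.exp_conj]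
  simp [Complex.conj_ofNat]

lemma conj_kernel (β t : ℝ) : 1 / (1 - Complex.exp (-(t:ℂ)) * e2pi (-β)) =
    (starRingEnd ℂ) (1 / (1 - Complex.exp (-(t:ℂ)) * e2pi β)) := by
  rw [e2pi_neg]
  simp [← Complex.exp_conj]

lemma kernel_bound {β : ℝ} {t : ℝ} (ht : 0 < t) (h : e2pi β ≠ 1) :
    ‖1 / (1 - Complex.exp (-(t:ℂ)) * e2pi β)‖ ≤ 2 / ‖1 - e2pi β‖ := by
  have h0 : 0 < ‖1 - e2pi β‖ := norm_pos_iff.mpr (sub_ne_zero.mpr (Ne.symm h))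
  have he : Real.exp (-t) < 1 := Real.exp_lt_one_iff.mpr (by linarith)
  set w := Complex.exp (-(t:ℂ)) * e2pi β with hw
  have h1 : 1 - Real.exp (-t) ≤ ‖1 - w‖ := by
    have := norm_sub_norm_le (1:ℂ) w
    rw [norm_exp_e2pi] at this
    simpa using this
  have h2 : ‖w - e2pi β‖ = 1 - Real.exp (-t) := by
    have : w - e2pi β = ((Real.exp (-t) - 1 : ℝ) : ℂ) * e2pi β := by
      rw [hw]; push_cast; ring
    rw [this, norm_mul, Complex.norm_real, Real.norm_eq_abs, abs_of_neg (by linarith)]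
    have : ‖e2pi β‖ = 1 := by simp [e2pi, Complex.norm_exp]
    rw [this]; ring
  have h3 : ‖1 - e2pi β‖ ≤ ‖1 - w‖ + ‖w - e2pi β‖ := by
    have := norm_add_le (1 - w) (w - e2pi β)
    simpa using this
  have h4 : ‖1 - e2pi β‖ / 2 ≤ ‖1 - w‖ := by linarith
  rw [norm_div, norm_one, show 2 / ‖1 - e2pi β‖ = 1 / (‖1 - e2pi β‖ / 2) by field_simp]
  exact one_div_le_one_div_of_le (by positivity) h4

lemma ae_summable_aux {ι : Type*} [Countable ι] {μ : Measure ℝ} {F : ι → ℝ → ℂ}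
    (hF : ∀ i, Integrable (F i) μ) (hs : Summable fun i => ∫ a, ‖F i a‖ ∂μ) :
    (∀ᵐ a ∂μ, Summable fun i => F i a) ∧ Integrable (fun a => ∑' i, F i a) μ := by
  have hfin : ∑' i, ∫⁻ a, ‖F i a‖ₑ ∂μ ≠ ⊤ := by
    have : ∀ i, ∫⁻ a, ‖F i a‖ₑ ∂μ = ENNReal.ofReal (∫ a, ‖F i a‖ ∂μ) := fun i => by
      rw [ofReal_integral_norm_eq_lintegral_enorm (hF i)]
    simp_rw [this]
    rw [← ENNReal.ofReal_tsum_of_nonneg (fun i => integral_nonneg fun _ => norm_nonneg _) hs]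
    exact ENNReal.ofReal_ne_top
  have hm : ∀ i, AEMeasurable (fun a => ‖F i a‖ₑ) μ := fun i => (hF i).1.enorm
  rw [← lintegral_tsum hm] at hfin
  have hae : ∀ᵐ a ∂μ, Summable fun i => F i a := by
    refine (ae_lt_top' (AEMeasurable.tsum hm) hfin).mono ?_
    intro x hx
    apply Summable.of_nnnorm
    rw [← ENNReal.tsum_coe_ne_top_iff_summable]
    exact hx.ne
  refine ⟨hae, ?_, ?_⟩
  · refine aestronglyMeasurable_of_tendsto_ae (u := (atTop : Filter (Finset ι)))
      (f := fun s a => ∑ i ∈ s, F i a) ?_ ?_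
    · intro s
      exact s.aestronglyMeasurable_fun_sum fun n _ => (hF n).1
    · filter_upwards [hae] with a ha using ha.hasSum
  · refine lt_of_le_of_lt (lintegral_mono fun a => enorm_tsum_le_tsum_enorm) hfin.lt_top

/-- coefficients -/
def cn (j : ℕ) (α : ℝ) (n : ℕ) : ℂ := e2pi ((n + 1) * α) / ((n + 1 : ℕ) : ℂ) ^ (j + 1)

/-- `2π|m+β|` -/
def am (β : ℝ) (m : ℤ) : ℝ := 2 * Real.pi * |m + β|

/-- terms of the polylogarithm -/
def FL (j : ℕ) (α x : ℝ) (n : ℕ) (t : ℝ) : ℂ := cn j α n * (Real.exp (-((n + 1) * x) * t) : ℝ)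

/-- terms on the left -/
def FF (j : ℕ) (α x β : ℝ) (p : ℕ × ℤ) (t : ℝ) : ℂ := FL j α x p.1 t * (pk β p.2 t : ℝ)

/-- terms on the right -/
def GG (j : ℕ) (α x β : ℝ) (p : ℕ × ℤ) (u : ℝ) : ℂ :=
  ((2 * u / (u ^ 2 + x ^ 2) : ℝ) : ℂ) * FL j α (am β p.2) p.1 u

lemma norm_e2pi (β : ℝ) : ‖e2pi β‖ = 1 := by simp [e2pi, Complex.norm_exp]

lemma e2pi_pow (α : ℝ) (n : ℕ) : e2pi α ^ (n + 1) = e2pi ((n + 1) * α) := by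
  rw [e2pi, e2pi, ← Complex.exp_nat_mul]
  congr 1
  push_cast
  ring

lemma norm_cn (j : ℕ) (α : ℝ) (n : ℕ) : ‖cn j α n‖ = 1 / ((n + 1 : ℕ) : ℝ) ^ (j + 1) := by
  rw [cn, norm_div, norm_e2pi, norm_pow, Complex.norm_natCast]

lemma norm_FL (j : ℕ) (α x : ℝ) (n : ℕ) (t : ℝ) :
    ‖FL j α x n t‖ = ‖cn j α n‖ * Real.exp (-((n + 1) * x) * t) := by
  rw [FL, norm_mul, Complex.norm_real, Real.norm_eq_abs, abs_of_pos (Real.exp_pos _)]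

lemma exp_norm_lt {x t : ℝ} (hx : 0 < x) (ht : 0 < t) (α : ℝ) :
    ‖Complex.exp (-(x:ℂ) * t) * e2pi α‖ < 1 := by
  rw [norm_mul, norm_e2pi, mul_one, Complex.norm_exp, Real.exp_lt_one_iff]
  have : 0 < x * t := by positivity
  simpa using this

lemma Li_hasSum (j : ℕ) {z : ℂ} (hz : ‖z‖ < 1) :
    HasSum (fun n : ℕ => z ^ (n + 1) / ((n + 1 : ℕ) : ℂ) ^ (j + 1)) (Li (j + 1) z) := by
  rcases j with _ | j
  · simpa [Li] using Complex.hasSum_taylorSeries_neg_log' hz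
  · rw [Li]
    apply Summable.hasSum
    apply Summable.of_norm
    have hg : Summable (fun n : ℕ => ‖z‖ ^ n) := summable_geometric_of_lt_one (norm_nonneg _) hz
    refine Summable.of_nonneg_of_le (fun _ => norm_nonneg _) (fun n => ?_) hg
    rw [norm_div, norm_pow, norm_pow, Complex.norm_natCast]
    have h1 : (1:ℝ) ≤ ((n + 1 : ℕ) : ℝ) ^ (j + 1 + 1) := one_le_pow₀ (by push_cast; linarith [Nat.cast_nonneg (α := ℝ) n])
    calc ‖z‖ ^ (n + 1) / ((n + 1 : ℕ) : ℝ) ^ (j + 1 + 1) ≤ ‖z‖ ^ (n + 1) :=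
          div_le_self (by positivity) h1
      _ ≤ ‖z‖ ^ n := pow_le_pow_of_le_one (norm_nonneg _) hz.le (Nat.le_succ n)

lemma FL_hasSum (j : ℕ) (α : ℝ) {x t : ℝ} (hx : 0 < x) (ht : 0 < t) :
    HasSum (fun n => FL j α x n t) (Li (j + 1) (Complex.exp (-(x:ℂ) * t) * e2pi α)) := by
  convert Li_hasSum j (exp_norm_lt hx ht α) using 2 with n
  rw [FL, cn, mul_pow, e2pi_pow, ← Complex.exp_nat_mul]
  push_cast
  rw [show ((n:ℂ) + 1) * (-(x:ℂ) * t) = -((n + 1) * x) * t by ring]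
  ring

lemma FL_norm_summable (j : ℕ) (α : ℝ) {x t : ℝ} (hx : 0 < x) (ht : 0 < t) :
    Summable (fun n => ‖FL j α x n t‖) := (FL_hasSum j α hx ht).summable.norm

lemma rate_pos (n : ℕ) {x : ℝ} (hx : 0 < x) : 0 < ((n:ℝ) + 1) * x := by positivity

lemma FL_integrable (j : ℕ) (α : ℝ) {x : ℝ} (hx : 0 < x) (n : ℕ) :
    Integrable (FL j α x n) (volume.restrict (Ioi 0)) := by
  have := integrableOn_exp_mul_Ioi (a := -((n + 1) * x)) (by linarith [rate_pos n hx]) 0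
  exact (this.ofReal (𝕜 := ℂ)).const_mul (cn j α n)

lemma exp_integral (n : ℕ) {x : ℝ} (hx : 0 < x) :
    ∫ t in Ioi (0:ℝ), Real.exp (-((n + 1) * x) * t) = 1 / ((n + 1) * x) := by
  rw [integral_exp_mul_Ioi (by linarith [rate_pos n hx])]
  simp

lemma FL_integral (j : ℕ) (α : ℝ) {x : ℝ} (hx : 0 < x) (n : ℕ) :
    ∫ t in Ioi (0:ℝ), FL j α x n t = cn j α n * ((1 / ((n + 1) * x) : ℝ) : ℂ) := by
  unfold FL
  rw [integral_const_mul, integral_complex_ofReal, exp_integral n hx]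

lemma FL_norm_integral (j : ℕ) (α : ℝ) {x : ℝ} (hx : 0 < x) (n : ℕ) :
    ∫ t in Ioi (0:ℝ), ‖FL j α x n t‖ = ‖cn j α n‖ * (1 / ((n + 1) * x)) := by
  simp_rw [norm_FL]
  rw [integral_const_mul, exp_integral n hx]

lemma coef_summable (j : ℕ) (α : ℝ) (x : ℝ) :
    Summable (fun n : ℕ => ‖cn j α n‖ * (1 / ((n + 1) * x))) := by
  have h : Summable (fun n : ℕ => 1 / (n : ℝ) ^ (j + 2)) :=
    Real.summable_one_div_nat_pow.mpr (by omega)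
  have h2 := ((summable_nat_add_iff 1).mpr h).mul_right (1 / x)
  refine h2.congr fun n => ?_
  rw [norm_cn]
  push_cast
  rw [pow_succ _ (j + 1)]
  simp only [one_div, mul_inv]
  ring

lemma FL_sum_facts (j : ℕ) (α : ℝ) {x : ℝ} (hx : 0 < x) :
    Integrable (fun t : ℝ => Li (j + 1) (Complex.exp (-(x:ℂ) * t) * e2pi α))
      (volume.restrict (Ioi 0)) ∧
    ∫ t in Ioi (0:ℝ), Li (j + 1) (Complex.exp (-(x:ℂ) * t) * e2pi α) =
      (x:ℂ)⁻¹ * Li (j + 2) (e2pi α) := by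
  have hs : Summable fun n => ∫ t in Ioi (0:ℝ), ‖FL j α x n t‖ := by
    simp_rw [FL_norm_integral j α hx]
    exact coef_summable j α x
  have h1 := (ae_summable_aux (FL_integrable j α hx) hs).2
  have h2 := integral_tsum_of_summable_integral_norm (FL_integrable j α hx) hs
  have he : (fun t => ∑' n, FL j α x n t) =ᵐ[volume.restrict (Ioi 0)]
      fun t : ℝ => Li (j + 1) (Complex.exp (-(x:ℂ) * t) * e2pi α) := by
    filter_upwards [ae_restrict_mem measurableSet_Ioi] with t ht
    exact (FL_hasSum j α hx ht).tsum_eq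
  refine ⟨h1.congr he, ?_⟩
  rw [← integral_congr_ae he, ← h2]
  simp_rw [FL_integral j α hx]
  rw [Li, ← tsum_mul_left]
  refine tsum_congr fun n => ?_
  rw [cn, e2pi_pow]
  push_cast
  rw [pow_succ _ (j + 1)]
  have : (n:ℂ) + 1 ≠ 0 := by exact_mod_cast Nat.succ_ne_zero n
  have : (x:ℂ) ≠ 0 := by exact_mod_cast hx.ne'
  field_simp

lemma pk_sum_le {β : ℝ} (hβ : e2pi β ≠ 1) (s : Finset ℤ) {t : ℝ} (ht : 0 < t) :
    ∑ m ∈ s, pk β m t ≤ 2 * (2 / ‖1 - e2pi β‖) := by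
  refine (sum_le_hasSum s (fun m _ => pk_nonneg β m ht) (pk_hasSum β ht)).trans ?_
  have h1 := kernel_bound ht hβ
  have h2 := Complex.re_le_norm (1 / (1 - Complex.exp (-(t:ℂ)) * e2pi β))
  linarith

lemma pk_le {β : ℝ} (hβ : e2pi β ≠ 1) (m : ℤ) {t : ℝ} (ht : 0 < t) :
    pk β m t ≤ 2 * (2 / ‖1 - e2pi β‖) := by
  simpa using pk_sum_le hβ {m} ht

lemma pk_measurable (β : ℝ) (m : ℤ) : Measurable (pk β m) := by
  unfold pk; fun_prop

lemma FF_integrable (j : ℕ) (α : ℝ) {x β : ℝ} (hx : 0 < x) (hβ : e2pi β ≠ 1) (p : ℕ × ℤ) :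
    Integrable (FF j α x β p) (volume.restrict (Ioi 0)) := by
  refine Integrable.mul_bdd (c := 2 * (2 / ‖1 - e2pi β‖)) (FL_integrable j α hx p.1) ?_ ?_
  · exact (Complex.measurable_ofReal.comp (pk_measurable β p.2)).aestronglyMeasurable
  · filter_upwards [ae_restrict_mem measurableSet_Ioi] with t ht
    rw [Complex.norm_real, Real.norm_eq_abs, abs_of_nonneg (pk_nonneg β p.2 ht)]
    exact pk_le hβ p.2 ht

lemma FF_norm_summable (j : ℕ) (α : ℝ) {x β : ℝ} (hx : 0 < x) (hβ : e2pi β ≠ 1) :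
    Summable (fun p => ∫ t in Ioi (0:ℝ), ‖FF j α x β p t‖) := by
  set C := 2 * (2 / ‖1 - e2pi β‖) with hC
  have key : ∀ (n : ℕ) (s : Finset ℤ), ∑ m ∈ s, ∫ t in Ioi (0:ℝ), ‖FF j α x β (n, m) t‖ ≤
      ‖cn j α n‖ * (1 / ((n + 1) * x)) * C := by
    intro n s
    rw [← integral_finsetSum _ (fun m _ => (FF_integrable j α hx hβ (n, m)).norm),
      ← FL_norm_integral j α hx n, ← integral_mul_const]
    refine setIntegral_mono_on (integrable_finsetSum _
      (fun m _ => (FF_integrable j α hx hβ (n, m)).norm))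
      ((FL_integrable j α hx n).norm.mul_const C) measurableSet_Ioi fun t ht => ?_
    have : ∑ m ∈ s, ‖FF j α x β (n, m) t‖ = ‖FL j α x n t‖ * ∑ m ∈ s, pk β m t := by
      rw [Finset.mul_sum]
      refine Finset.sum_congr rfl fun m _ => ?_
      rw [FF, norm_mul, Complex.norm_real, Real.norm_eq_abs, abs_of_nonneg (pk_nonneg β m ht)]
    rw [this]
    exact mul_le_mul_of_nonneg_left (pk_sum_le hβ s ht) (norm_nonneg _)
  have nn : ∀ p, 0 ≤ ∫ t in Ioi (0:ℝ), ‖FF j α x β p t‖ :=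
    fun p => integral_nonneg fun _ => norm_nonneg _
  rw [summable_prod_of_nonneg nn]
  refine ⟨fun n => summable_of_sum_le (fun m => nn (n, m)) (key n), ?_⟩
  refine Summable.of_nonneg_of_le (fun n => tsum_nonneg fun m => nn (n, m))
    (fun n => Real.tsum_le_of_sum_le (fun m => nn (n, m)) (key n))
    ((coef_summable j α x).mul_right C)

lemma am_pos {β : ℝ} (hβ0 : 0 < β) (hβ1 : β < 1) (m : ℤ) : 0 < am β m := by
  have : (m : ℝ) + β ≠ 0 := by
    intro h
    have h1 : (m:ℝ) < 0 := by linarith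
    have h2 : (-1:ℝ) < m := by linarith
    have h3 : m < 0 := by exact_mod_cast h1
    have h4 : -1 < m := by exact_mod_cast h2
    omega
  unfold am
  have := Real.pi_pos
  positivity

lemma GG_eq (j : ℕ) (α : ℝ) {x β : ℝ} (hx : 0 < x) (p : ℕ × ℤ) (ha : 0 < am β p.2) :
    GG j α x β p = fun u => (am β p.2 / x) • FF j α x β p ((am β p.2 / x) * u) := by
  funext u
  unfold GG FF FL pk
  have h0 : 2 * Real.pi * |(p.2:ℝ) + β| = am β p.2 := rfl
  rw [h0]
  set a := am β p.2
  rw [show -(((p.1:ℝ) + 1) * x) * (a / x * u) = -((p.1 + 1) * a) * u by field_simp]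
  have : 2 * u / (u ^ 2 + x ^ 2) = (a / x) * (2 * (a / x * u) / ((a / x * u) ^ 2 + a ^ 2)) := by
    have h1 : (a / x * u) ^ 2 + a ^ 2 = (a / x) ^ 2 * (u ^ 2 + x ^ 2) := by field_simp
    rw [h1]
    have : u ^ 2 + x ^ 2 ≠ 0 := by positivity
    field_simp
  rw [this, Complex.real_smul]
  push_cast
  ring

lemma GG_integrable (j : ℕ) (α : ℝ) {x β : ℝ} (hx : 0 < x) (hβ0 : 0 < β) (hβ1 : β < 1)
    (p : ℕ × ℤ) : Integrable (GG j α x β p) (volume.restrict (Ioi 0)) := by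
  have ha := am_pos hβ0 hβ1 p.2
  rw [GG_eq j α hx p ha]
  have := (integrableOn_Ioi_comp_mul_left_iff (FF j α x β p) 0 (div_pos ha hx)).mpr
    (by rw [mul_zero]; exact FF_integrable j α hx (e2pi_ne_one hβ0 hβ1) p)
  exact this.smul (am β p.2 / x)

lemma GG_integral (j : ℕ) (α : ℝ) {x β : ℝ} (hx : 0 < x) (hβ0 : 0 < β) (hβ1 : β < 1)
    (p : ℕ × ℤ) : ∫ u in Ioi (0:ℝ), GG j α x β p u = ∫ t in Ioi (0:ℝ), FF j α x β p t := by
  have ha := am_pos hβ0 hβ1 p.2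
  rw [GG_eq j α hx p ha, integral_smul, integral_comp_mul_left_Ioi' _ _ (div_pos ha hx), mul_zero]

lemma GG_norm_integral (j : ℕ) (α : ℝ) {x β : ℝ} (hx : 0 < x) (hβ0 : 0 < β) (hβ1 : β < 1)
    (p : ℕ × ℤ) : ∫ u in Ioi (0:ℝ), ‖GG j α x β p u‖ = ∫ t in Ioi (0:ℝ), ‖FF j α x β p t‖ := by
  have ha := am_pos hβ0 hβ1 p.2
  rw [GG_eq j α hx p ha]
  simp_rw [norm_smul, Real.norm_of_nonneg (div_pos ha hx).le]
  rw [integral_const_mul]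
  have := integral_comp_mul_left_Ioi' (fun t => ‖FF j α x β p t‖) 0 (div_pos ha hx)
  rw [mul_zero, smul_eq_mul] at this
  exact this

lemma dedekind_term (j : ℕ) (α b u : ℝ) (m : ℤ) (n : ℕ) :
    ((n + 1 : ℕ) : ℂ) ^ (((2:ℂ) - ((j + 2 : ℕ) : ℂ)) - 1) *
      Complex.exp (2 * Real.pi * Complex.I * (n + 1) * ((α : ℂ) + (b : ℂ) * (Complex.I * u))) *
      Complex.exp (2 * Real.pi * Complex.I * (m : ℂ) * (n + 1) * (Complex.I * u)) =
    FL j α (2 * Real.pi * (m + b)) n u := by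
  have h1 : ((2:ℂ) - ((j + 2 : ℕ) : ℂ)) - 1 = -((j + 1 : ℕ) : ℂ) := by push_cast; ring
  rw [h1, Complex.cpow_neg, Complex.cpow_natCast, mul_assoc, ← Complex.exp_add, FL, cn, e2pi,
    Complex.ofReal_exp, div_mul_eq_mul_div, ← Complex.exp_add, mul_comm, ← div_eq_mul_inv]
  congr 2
  push_cast
  ring_nf
  simp
  ring

lemma dedekind_sum (j : ℕ) (α : ℝ) {β : ℝ} (hβ0 : 0 < β) (hβ1 : β < 1) (u : ℝ)
    (hs : Summable fun p : ℕ × ℤ => FL j α (am β p.2) p.1 u) :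
    dedekindA (Complex.I * u) ((2 : ℂ) - ((j + 2 : ℕ) : ℂ)) β α +
      dedekindA (Complex.I * u) ((2 : ℂ) - ((j + 2 : ℕ) : ℂ)) (-β) α =
    ∑' p : ℕ × ℤ, FL j α (am β p.2) p.1 u := by
  set h : ℤ → ℂ := fun m => ∑' n, FL j α (am β m) n u with hh
  have hs' : Summable fun p : ℤ × ℕ => FL j α (am β p.1) p.2 u :=
    hs.prod_symm
  have hsum : Summable h := hs'.prod
  have htot : ∑' p : ℕ × ℤ, FL j α (am β p.2) p.1 u = ∑' m, h m := by
    rw [← hs'.tsum_prod]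
    exact ((Equiv.prodComm ℤ ℕ).tsum_eq (fun p : ℕ × ℤ => FL j α (am β p.2) p.1 u)).symm
  rw [htot, ← hsum.tsum_subtype_add_tsum_subtype_compl {m : ℤ | -β < (m:ℝ)}]
  congr 1
  · unfold dedekindA
    refine tsum_congr fun m => tsum_congr fun n => ?_
    rw [dedekind_term]
    have hm : -β < ((m : ℤ) : ℝ) := m.2
    rw [am, abs_of_pos (by linarith)]
  · have hne : ∀ m : ℤ, (m:ℝ) ≠ -β := by
      intro m hm
      have := am_pos hβ0 hβ1 m
      rw [am, hm] at this
      simp at this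
    let e : {m : ℤ // -(-β) < (m : ℝ)} ≃ ({m : ℤ | -β < (m:ℝ)}ᶜ : Set ℤ) :=
      { toFun := fun m => ⟨-m.1, by
          have := m.2
          simp only [Set.mem_compl_iff, Set.mem_ofPred_eq, Int.cast_neg]
          linarith⟩
        invFun := fun m => ⟨-m.1, by
          have h1 := m.2
          simp only [Set.mem_compl_iff, Set.mem_ofPred_eq, not_lt] at h1
          have h2 := lt_of_le_of_ne h1 (hne m.1)
          push_cast
          linarith⟩
        left_inv := fun m => by simp
        right_inv := fun m => by simp }
    rw [← e.tsum_eq]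
    unfold dedekindA
    refine tsum_congr fun m => tsum_congr fun n => ?_
    rw [dedekind_term]
    have hm : -(-β) < ((m : ℤ) : ℝ) := m.2
    have h2 : ((e m : ℤ) : ℝ) = -((m : ℤ) : ℝ) := by simp [e]
    rw [am, h2, abs_of_neg (by linarith)]
    congr 2
    ring

lemma kernel_eq {x : ℝ} (hx : 0 < x) (u : ℝ) :
    ((Complex.I * u + x)⁻¹ + (Complex.I * u - x)⁻¹) =
      -Complex.I * ((2 * u / (u ^ 2 + x ^ 2) : ℝ) : ℂ) := by
  have h1 : (Complex.I * u + x) ≠ 0 := by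
    intro h
    have := congrArg Complex.re h
    simp at this
    exact hx.ne' this
  have h2 : (Complex.I * u - x) ≠ 0 := by
    intro h
    have := congrArg Complex.re h
    simp at this
    exact hx.ne' this
  have h3 : ((u:ℂ) ^ 2 + (x:ℂ) ^ 2) ≠ 0 := by
    have : u ^ 2 + x ^ 2 ≠ 0 := by positivity
    exact_mod_cast this
  push_cast
  field_simp
  ring_nf
  simp

/-- Connection between the higher Herglotz–Zagier–Novikov function and Berndt's generalized
Dedekind eta-function: for `k ≥ 2`, `0 < β < 1` and real `x > 0`,
`𝓕_k(x;α,β) + 𝓕_k(x;α,-β) = (1/x) Li_k(e^{2πiα})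
  + i∫₀^∞ (1/(iu+x) + 1/(iu-x)) (A(iu,2-k,β,α) + A(iu,2-k,-β,α)) du`. -/
theorem HHZN_dedekind_eta_connection (k : ℕ) (hk : 2 ≤ k) (α β x : ℝ)
    (hβ0 : 0 < β) (hβ1 : β < 1) (hx : 0 < x) :
    IntegrableOn
      (fun u : ℝ => ((Complex.I * u + x)⁻¹ + (Complex.I * u - x)⁻¹) *
        (dedekindA (Complex.I * u) ((2 : ℂ) - k) β α +
          dedekindA (Complex.I * u) ((2 : ℂ) - k) (-β) α))
      (Set.Ioi 0) ∧
    HHZN k x α β + HHZN k x α (-β)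
      = (x : ℂ)⁻¹ * Li k (e2pi α) +
        Complex.I * ∫ u in Set.Ioi (0 : ℝ),
          ((Complex.I * u + x)⁻¹ + (Complex.I * u - x)⁻¹) *
            (dedekindA (Complex.I * u) ((2 : ℂ) - k) β α +
              dedekindA (Complex.I * u) ((2 : ℂ) - k) (-β) α) := by
  obtain ⟨j, rfl⟩ : ∃ j, k = j + 2 := ⟨k - 2, by omega⟩
  have hβ := e2pi_ne_one hβ0 hβ1
  have hβ' : e2pi (-β) ≠ 1 := by
    intro h
    rw [e2pi_neg] at h
    apply hβ
    have := congrArg (starRingEnd ℂ) h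
    simpa using this
  have hGs : Summable fun p => ∫ u in Ioi (0:ℝ), ‖GG j α x β p u‖ := by
    simp_rw [GG_norm_integral j α hx hβ0 hβ1]
    exact FF_norm_summable j α hx hβ
  have hGi := GG_integrable j α hx hβ0 hβ1
  obtain ⟨hGae, hGint⟩ := ae_summable_aux hGi hGs
  have heq : (fun u : ℝ => ((Complex.I * u + x)⁻¹ + (Complex.I * u - x)⁻¹) *
        (dedekindA (Complex.I * u) ((2 : ℂ) - ((j + 2 : ℕ) : ℂ)) β α +
          dedekindA (Complex.I * u) ((2 : ℂ) - ((j + 2 : ℕ) : ℂ)) (-β) α))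
      =ᵐ[volume.restrict (Ioi 0)] fun u => -Complex.I * ∑' p, GG j α x β p u := by
    filter_upwards [hGae, ae_restrict_mem measurableSet_Ioi] with u hu hu0
    have hu0' : (0:ℝ) < u := hu0
    have hne : ((2 * u / (u ^ 2 + x ^ 2) : ℝ) : ℂ) ≠ 0 := by
      have : 2 * u / (u ^ 2 + x ^ 2) ≠ 0 := by positivity
      exact_mod_cast this
    have hs : Summable fun p : ℕ × ℤ => FL j α (am β p.2) p.1 u :=
      (summable_mul_left_iff hne).mp hu
    rw [dedekind_sum j α hβ0 hβ1 u hs, kernel_eq hx, mul_assoc, ← tsum_mul_left]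
    rfl
  refine ⟨(hGint.const_mul (-Complex.I)).congr heq.symm, ?_⟩
  rw [integral_congr_ae heq, integral_const_mul, ← mul_assoc,
    show Complex.I * -Complex.I = 1 by simp, one_mul,
    ← integral_tsum_of_summable_integral_norm hGi hGs]
  simp_rw [GG_integral j α hx hβ0 hβ1]
  rw [integral_tsum_of_summable_integral_norm (FF_integrable j α hx hβ)
    (FF_norm_summable j α hx hβ)]
  obtain ⟨hLint, hLval⟩ := FL_sum_facts j α hx
  have hFint := (ae_summable_aux (FF_integrable j α hx hβ) (FF_norm_summable j α hx hβ)).2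
  rw [← hLval, ← integral_add hLint hFint]
  have hI : ∀ b : ℝ, e2pi b ≠ 1 → Integrable (fun t : ℝ =>
      Li (j + 1) (Complex.exp (-(x:ℂ) * t) * e2pi α) *
        (1 / (1 - Complex.exp (-(t:ℂ)) * e2pi b))) (volume.restrict (Ioi 0)) := by
    intro b hb
    refine hLint.mul_bdd (c := 2 / ‖1 - e2pi b‖) ?_ ?_
    · apply Measurable.aestronglyMeasurable
      fun_prop
    · filter_upwards [ae_restrict_mem measurableSet_Ioi] with t ht
      exact kernel_bound ht hb
  unfold HHZN
  simp only [show j + 2 - 1 = j + 1 from rfl]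
  simp_rw [div_eq_mul_one_div (Li _ _)]
  rw [← integral_add (hI β hβ) (hI (-β) hβ')]
  refine setIntegral_congr_fun measurableSet_Ioi fun t ht => ?_
  have ht' : (0:ℝ) < t := ht
  have hP := pk_hasSum β ht'
  have hPs : Summable fun m : ℤ => ‖((pk β m t : ℝ) : ℂ)‖ := by
    refine hP.summable.congr fun m => ?_
    rw [Complex.norm_real, Real.norm_of_nonneg (pk_nonneg β m ht')]
  have h1 := tsum_mul_tsum_of_summable_norm (FL_norm_summable j α hx ht') hPs
  have h2 : ∑' p, FF j α x β p t = Li (j + 1) (Complex.exp (-(x:ℂ) * t) * e2pi α) *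
      ((2 * (1 / (1 - Complex.exp (-(t:ℂ)) * e2pi β)).re - 1 : ℝ) : ℂ) := by
    rw [← (FL_hasSum j α hx ht').tsum_eq, ← hP.tsum_eq, Complex.ofReal_tsum, h1]
    rfl
  have h3 := conj_kernel β t
  have h4 := Complex.add_conj (1 / (1 - Complex.exp (-(t:ℂ)) * e2pi β))
  beta_reduce
  rw [h2, h3, ← mul_add, h4]
  push_cast
  ring

end
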